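/- For δ₁ ∈ [0, 1) and δ₂ > 0, define q : (0, 1) → ℝ by q(x) = (1 − x)² + x·(1 − x^{1−δ₁}) − (1 − x^{1+δ₂})² (real powers). Then there exists a unique x* ∈ (0, 1) with q(x*) = 0; moreover q(x) < 0 for all x ∈ (0, x*) and q(x) ≥ 0 for all x ∈ [x*, 1). -/

import Mathlib

open Set

/-- `q δ₁ δ₂ x = (1-x)² + x(1 - x^{1-δ₁}) - (1 - x^{1+δ₂})²`, with real powers. -/
noncomputable def qPoly (δ₁ δ₂ x : ℝ) : ℝ :=
  (1 - x) ^ 2 + x * (1 - x ^ (1 - δ₁)) - (1 - x ^ (1 + δ₂)) ^ 2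

/-- Tangent-line inequality for `t log t`, strict away from the tangency point. -/
lemma phi_tangent (s t : ℝ) (hs : 0 < s) (ht : 0 < t) :
    t * Real.log t + (s - t) * (Real.log t + 1) ≤ s * Real.log s := by
  have h := Real.log_le_sub_one_of_pos (div_pos ht hs)
  rw [Real.log_div ht.ne' hs.ne'] at h
  have h2 := mul_le_mul_of_nonneg_left h hs.le
  have h3 : s * (t / s - 1) = t - s := by field_simp
  nlinarith

lemma phi_tangent_lt (s t : ℝ) (hs : 0 < s) (ht : 0 < t) (hst : s < t) :
    t * Real.log t + (s - t) * (Real.log t + 1) < s * Real.log s := by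
  have h := Real.log_lt_sub_one_of_pos (div_pos ht hs) (by
    rw [Ne, div_eq_one_iff_eq hs.ne']; exact hst.ne')
  rw [Real.log_div ht.ne' hs.ne'] at h
  have h2 := mul_lt_mul_of_pos_left h hs
  have h3 : s * (t / s - 1) = t - s := by field_simp
  nlinarith

/-- Karamata for `t log t`: `(1,z,w)` majorizes `(x,y,y)`. -/
lemma karamata_log (x y z w : ℝ) (hx0 : 0 < x) (hx1 : x < 1) (hy0 : 0 < y) (hy1 : y < 1)
    (hz : 0 < z) (hw : 0 < w) (hwx : w < x) (hwy : w < y) (hsum : 1 + z + w = x + 2 * y) :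
    x * Real.log x + 2 * (y * Real.log y) < z * Real.log z + w * Real.log w := by
  rcases le_total x y with h | h
  · have hl := Real.log_le_log hx0 h
    have e1 := phi_tangent 1 y one_pos hy0
    have e2 := phi_tangent z y hz hy0
    have e3 := phi_tangent_lt w x hw hx0 hwx
    have e4 := mul_nonneg (sub_nonneg.2 hwx.le) (sub_nonneg.2 hl)
    have hz' : z = x + 2 * y - 1 - w := by linarith
    rw [Real.log_one] at e1
    have e5 : (1 - y) * (Real.log y + 1) + (z - y) * (Real.log y + 1)
        = (x - w) * (Real.log y + 1) := by rw [hz']; ring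
    nlinarith
  · have hl := Real.log_le_log hy0 h
    have e1 := phi_tangent 1 x one_pos hx0
    have e2 := phi_tangent z y hz hy0
    have e3 := phi_tangent_lt w y hw hy0 hwy
    have e4 := mul_nonneg (sub_nonneg.2 hx1.le) (sub_nonneg.2 hl)
    have hz' : z = x + 2 * y - 1 - w := by linarith
    rw [Real.log_one] at e1
    have e5 : (w - y) * (Real.log y + 1) + (z - y) * (Real.log y + 1)
        = (x - 1) * (Real.log y + 1) := by rw [hz']; ring
    nlinarith

/-- `q(x) / x`. -/
noncomputable def rFun (a b x : ℝ) : ℝ := -1 + x - x ^ a + 2 * x ^ b - x ^ (1 + 2 * b)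

noncomputable def rDer (a b x : ℝ) : ℝ :=
  1 - a * x ^ (a - 1) + 2 * (b * x ^ (b - 1)) - (1 + 2 * b) * x ^ (1 + 2 * b - 1)

lemma rFun_hasDerivAt (a b x : ℝ) (hx : 0 < x) : HasDerivAt (rFun a b) (rDer a b x) x := by
  have h (p : ℝ) := Real.hasDerivAt_rpow_const (x := x) (p := p) (Or.inl hx.ne')
  have := ((((hasDerivAt_id x).const_add (-1)).sub (h a)).add ((h b).const_mul 2)).sub
    (h (1 + 2 * b))
  exact this

lemma rDer_pos (a b x : ℝ) (hb : 0 < b) (hx0 : 0 < x) (hx1 : x < 1)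
    (hr : rFun a b x = 0) : 0 < rDer a b x := by
  have hL := Real.log_neg hx0 hx1
  have hy0 : 0 < x ^ b := Real.rpow_pos_of_pos hx0 b
  have hy1 : x ^ b < 1 := Real.rpow_lt_one hx0.le hx1 hb
  have hz : 0 < x ^ a := Real.rpow_pos_of_pos hx0 a
  have hw : 0 < x ^ (1 + 2 * b) := Real.rpow_pos_of_pos hx0 _
  have hwx : x ^ (1 + 2 * b) < x := by
    conv_rhs => rw [← Real.rpow_one x]
    exact Real.rpow_lt_rpow_of_exponent_gt hx0 hx1 (by linarith)
  have hwy : x ^ (1 + 2 * b) < x ^ b :=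
    Real.rpow_lt_rpow_of_exponent_gt hx0 hx1 (by linarith)
  have k := karamata_log x (x ^ b) (x ^ a) (x ^ (1 + 2 * b)) hx0 hx1 hy0 hy1 hz hw hwx hwy
    (by unfold rFun at hr; linarith)
  rw [Real.log_rpow hx0, Real.log_rpow hx0, Real.log_rpow hx0] at k
  have key : x * rDer a b x
      = x - a * x ^ a + 2 * (b * x ^ b) - (1 + 2 * b) * x ^ (1 + 2 * b) := by
    unfold rDer
    rw [Real.rpow_sub_one hx0.ne', Real.rpow_sub_one hx0.ne', Real.rpow_sub_one hx0.ne']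
    field_simp
  have : (x * rDer a b x) * Real.log x < 0 := by rw [key]; nlinarith
  have h2 : 0 < x * rDer a b x := by
    by_contra hc
    push Not at hc
    nlinarith [mul_nonneg_of_nonpos_of_nonpos hc hL.le]
  exact (mul_pos_iff_of_pos_left hx0).1 h2

lemma eventually_left_lt (f : ℝ → ℝ) (d v : ℝ) (h : HasDerivAt f d v) (hd : 0 < d) :
    ∀ᶠ t in nhdsWithin v (Set.Iio v), f t < f v := by
  have h1 := (hasDerivAt_iff_tendsto_slope.1 h).eventually (lt_mem_nhds hd)
  have h2 : nhdsWithin v (Set.Iio v) ≤ nhdsWithin v {v}ᶜ :=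
    nhdsWithin_mono _ (fun t ht => ne_of_lt ht)
  filter_upwards [h2 h1, self_mem_nhdsWithin] with t ht htv
  have htv : t < v := htv
  rw [slope_comm, slope_def_field] at ht
  have := (div_pos_iff_of_pos_right (sub_pos.2 htv)).1 ht
  linarith

lemma rFun_step (a b u v : ℝ) (hb : 0 < b) (hu : 0 < u) (huv : u < v) (hv : v < 1)
    (hr : 0 ≤ rFun a b u) : 0 < rFun a b v := by
  have main : ∀ t ∈ Set.Icc u v, 0 ≤ rFun a b t := by
    intro t ht
    exact image_le_of_deriv_right_lt_deriv_boundary' (f := fun _ => (0 : ℝ)) (f' := fun _ => 0)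
      (B := rFun a b) (B' := rDer a b) continuousOn_const
      (fun x _ => (hasDerivAt_const x (0 : ℝ)).hasDerivWithinAt) hr
      (fun x hx => (rFun_hasDerivAt a b x (hu.trans_le hx.1)).continuousAt.continuousWithinAt)
      (fun x hx => (rFun_hasDerivAt a b x (hu.trans_le hx.1)).hasDerivWithinAt)
      (fun x hx he => rDer_pos a b x hb (hu.trans_le hx.1) (hx.2.trans hv) he.symm) ht
  refine lt_of_le_of_ne (main v ⟨huv.le, le_rfl⟩) (fun h0 => ?_)
  have hv0 := hu.trans huv
  have h1 := eventually_left_lt _ _ v (rFun_hasDerivAt a b v hv0) (rDer_pos a b v hb hv0 hv h0.symm)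
  obtain ⟨t, ht, ht2⟩ := (h1.and (Ioo_mem_nhdsLT huv)).exists
  have := main t ⟨ht2.1.le, ht2.2.le⟩
  linarith

lemma rFun_root (a b : ℝ) (ha : 0 < a) (hb : 0 < b) :
    ∃ x ∈ Set.Ioo (0 : ℝ) 1, rFun a b x = 0 := by
  have h1 : rFun a b 1 = 0 := by simp [rFun]; norm_num
  have hd : HasDerivAt (fun x => - rFun a b x) a 1 := by
    have := (rFun_hasDerivAt a b 1 one_pos).neg
    refine this.congr_deriv ?_
    simp only [rDer, Real.one_rpow]; ring
  have h2 := eventually_left_lt _ _ 1 hd ha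
  obtain ⟨t, ht, ht2⟩ := (h2.and (Ioo_mem_nhdsLT (zero_lt_one' ℝ))).exists
  have h0 : rFun a b 0 = -1 := by
    simp [rFun, Real.zero_rpow ha.ne', Real.zero_rpow hb.ne',
      Real.zero_rpow (by positivity : (1 + 2 * b) ≠ 0)]
  have hc : Continuous (rFun a b) := by
    have h (p : ℝ) (hp : 0 < p) := Real.continuous_rpow_const hp.le
    exact (((continuous_const.add continuous_id).sub (h a ha)).add
      (continuous_const.mul (h b hb))).sub (h _ (by positivity))
  obtain ⟨x, hx, hx2⟩ := intermediate_value_Ioo ht2.1.le hc.continuousOn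
    (show (0 : ℝ) ∈ Set.Ioo (rFun a b 0) (rFun a b t) from ⟨by linarith, by linarith⟩)
  exact ⟨x, ⟨hx.1, hx.2.trans ht2.2⟩, hx2⟩

lemma qPoly_eq (δ₁ δ₂ x : ℝ) (hx : 0 < x) :
    qPoly δ₁ δ₂ x = x * rFun (1 - δ₁) δ₂ x := by
  unfold qPoly rFun
  rw [Real.rpow_add hx 1 δ₂, Real.rpow_add hx 1 (2 * δ₂), two_mul δ₂, Real.rpow_add hx δ₂ δ₂,
    Real.rpow_one]
  ring

/-- for `δ₁ ∈ [0,1)` and `δ₂ > 0`, `q` has a unique root `x*` in `(0,1)`,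
is negative on `(0,x*)` and nonnegative on `[x*,1)`. -/
theorem qPoly_unique_root_sign (δ₁ δ₂ : ℝ) (h₁0 : 0 ≤ δ₁) (h₁1 : δ₁ < 1) (h₂ : 0 < δ₂) :
    ∃ xstar ∈ Ioo (0 : ℝ) 1,
      qPoly δ₁ δ₂ xstar = 0 ∧
      (∀ x ∈ Ioo (0 : ℝ) 1, qPoly δ₁ δ₂ x = 0 → x = xstar) ∧
      (∀ x ∈ Ioo (0 : ℝ) xstar, qPoly δ₁ δ₂ x < 0) ∧
      (∀ x ∈ Ico xstar (1 : ℝ), 0 ≤ qPoly δ₁ δ₂ x) := by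
  obtain ⟨s, hs, hs0⟩ := rFun_root (1 - δ₁) δ₂ (by linarith) h₂
  have huniq : ∀ x ∈ Ioo (0 : ℝ) s, rFun (1 - δ₁) δ₂ x < 0 := by
    intro x hx
    by_contra hc
    have := rFun_step (1 - δ₁) δ₂ x s h₂ hx.1 hx.2 hs.2 (not_lt.1 hc)
    linarith
  refine ⟨s, hs, ?_, ?_, ?_, ?_⟩
  · rw [qPoly_eq _ _ _ hs.1, hs0, mul_zero]
  · intro x hx hq
    rw [qPoly_eq _ _ _ hx.1] at hq
    have hr := (mul_eq_zero.1 hq).resolve_left hx.1.ne'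
    rcases lt_trichotomy x s with h | h | h
    · have := huniq x ⟨hx.1, h⟩
      linarith
    · exact h
    · have := rFun_step (1 - δ₁) δ₂ s x h₂ hs.1 h hx.2 hs0.ge
      linarith
  · intro x hx
    rw [qPoly_eq _ _ _ hx.1]
    exact mul_neg_of_pos_of_neg hx.1 (huniq x hx)
  · intro x hx
    have hx0 : 0 < x := hs.1.trans_le hx.1
    rw [qPoly_eq _ _ _ hx0]
    refine mul_nonneg hx0.le ?_
    rcases hx.1.eq_or_lt with h | h
    · rw [← h, hs0]
    · exact (rFun_step (1 - δ₁) δ₂ s x h₂ hs.1 h hx.2 hs0.ge).le
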